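/- arXiv:2510.15123 — 5 statements merged into one kernel-verified Lean document; each statement's English description precedes it below -/
import Mathlib

section
/- Let K be a convex subset of a real normed linear space X such that the metric double complement -(-K) is contained in K. Then -(-K) is a convex set. -/
/-- The metric complement of a subset `S` of a normed space: the set of points
bounded away from `S`. -/
def metricCompl {X : Type*} [NormedAddCommGroup X] (S : Set X) : Set X :=
  {x : X | ∃ r > 0, ∀ y ∈ S, r ≤ ‖x - y‖}

theorem metricCompl_eq_compl_closure {X : Type*} [NormedAddCommGroup X] (S : Set X) :
    metricCompl S = (closure S)ᶜ := by
  ext x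
  simp [metricCompl, Metric.mem_closure_iff, dist_eq_norm]

theorem metricCompl_metricCompl_eq_interior_closure {X : Type*} [NormedAddCommGroup X]
    (S : Set X) : metricCompl (metricCompl S) = interior (closure S) := by
  rw [metricCompl_eq_compl_closure, metricCompl_eq_compl_closure, closure_compl, compl_compl]

theorem convex_metricCompl_metricCompl_of_subset
    {X : Type*} [NormedAddCommGroup X] [NormedSpace ℝ X]
    (K : Set X) (hK : Convex ℝ K) (h : metricCompl (metricCompl K) ⊆ K) :
    Convex ℝ (metricCompl (metricCompl K)) := by
  rw [metricCompl_metricCompl_eq_interior_closure]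
  exact hK.closure.interior
end

section
/- Let X be a real normed linear space and K a convex subset of X with nonempty interior. Then the metric double complement -(-K) equals the interior of K. -/
theorem metricCompl_metricCompl_eq_interior_of_convex
    {X : Type*} [NormedAddCommGroup X] [NormedSpace ℝ X]
    (K : Set X) (hK : Convex ℝ K) (hint : (interior K).Nonempty) :
    metricCompl (metricCompl K) = interior K := by
  rw [metricCompl_eq_compl_closure, metricCompl_eq_compl_closure, closure_compl, compl_compl,
    hK.interior_closure_eq_interior_of_nonempty_interior hint]
end

section
/- Let K be a convex subset with nonempty interior in a real normed linear space X. Then the metric double complement -(-K) is dense in K; that is, K is contained in the closure of -(-K). -/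
/-- Interior points of `S` are bounded away from the metric complement of `S`. -/
theorem interior_subset_metricCompl_metricCompl {X : Type*} [NormedAddCommGroup X] (S : Set X) :
    interior S ⊆ metricCompl (metricCompl S) := by
  intro x hx
  obtain ⟨ε, hε, hball⟩ := Metric.mem_nhds_iff.mp (mem_interior_iff_mem_nhds.mp hx)
  refine ⟨ε, hε, fun y ⟨r, hr, hy⟩ => ?_⟩
  by_contra! hlt
  have hyS : y ∈ S := hball (by rwa [Metric.mem_ball, dist_comm, dist_eq_norm])
  have hle := hy y hyS
  rw [sub_self, norm_zero] at hle
  exact absurd hle (not_le.mpr hr)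

theorem metricCompl_metricCompl_dense_of_convex
    {X : Type*} [NormedAddCommGroup X] [NormedSpace ℝ X]
    (K : Set X) (hK : Convex ℝ K) (hint : (interior K).Nonempty) :
    K ⊆ closure (metricCompl (metricCompl K)) := by
  calc K ⊆ closure K := subset_closure
    _ = closure (interior K) :=
      (hK.closure_interior_eq_closure_of_nonempty_interior hint).symm
    _ ⊆ closure (metricCompl (metricCompl K)) :=
      closure_mono (interior_subset_metricCompl_metricCompl K)
end

section
/- Let X be a finite-dimensional real normed linear space and K a nonempty convex subset of X. Then the metric double complement -(-K) equals the interior of K. -/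
theorem Convex.interior_closure_eq_interior_of_finiteDimensional {X : Type*}
    [NormedAddCommGroup X] [NormedSpace ℝ X] [FiniteDimensional ℝ X] {K : Set X}
    (hK : Convex ℝ K) : interior (closure K) = interior K := by
  refine subset_antisymm (fun x hx ↦ ?_) (interior_mono subset_closure)
  have hspan : affineSpan ℝ K = ⊤ := by
    have hclosure : closure K ⊆ affineSpan ℝ K :=
      closure_minimal (subset_affineSpan ℝ K) (AffineSubspace.closed_of_finiteDimensional _)
    rw [eq_top_iff, ← hK.closure.interior_nonempty_iff_affineSpan_eq_top.1 ⟨x, hx⟩]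
    exact affineSpan_le.2 hclosure
  rwa [← hK.interior_closure_eq_interior_of_nonempty_interior
    (hK.interior_nonempty_iff_affineSpan_eq_top.2 hspan)]

theorem metricCompl_metricCompl_eq_interior_of_finiteDimensional
    {X : Type*} [NormedAddCommGroup X] [NormedSpace ℝ X]
    [FiniteDimensional ℝ X]
    (K : Set X) (hK : Convex ℝ K) (hne : K.Nonempty) :
    metricCompl (metricCompl K) = interior K := by
  rw [metricCompl_eq_compl_closure, metricCompl_eq_compl_closure, closure_compl, compl_compl,
    hK.interior_closure_eq_interior_of_finiteDimensional]
end

section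
/- Let X be a real normed linear space of finite dimension n, let a₁, …, a_{n+1} be affinely independent points of X, and let c be a point in the interior of the convex hull of {a₁, …, a_{n+1}}. Then there exists δ > 0 such that whenever x₁, …, x_{n+1} are points of X with ‖xₖ − aₖ‖ < δ for each k ≤ n + 1, the points x₁, …, x_{n+1} are affinely independent and c lies in the interior of the convex hull of {x₁, …, x_{n+1}}. -/
open Filter Topology in
theorem AffineBasis.eventually_mem_interior_convexHull {ι X : Type*} [Fintype ι]
    [NormedAddCommGroup X] [NormedSpace ℝ X] (b : AffineBasis ι ℝ X) {c : X}
    (hc : c ∈ interior (convexHull ℝ (Set.range b))) :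
    ∀ᶠ x in 𝓝 (b : ι → X),
      AffineIndependent ℝ x ∧ c ∈ interior (convexHull ℝ (Set.range x)) := by
  classical
  have : FiniteDimensional ℝ X := b.finiteDimensional
  have hM : Continuous fun x : ι → X => b.toMatrix x :=
    continuous_matrix fun i j => (continuous_barycentric_coord b j).comp (continuous_apply i)
  have hdet : ∀ᶠ x in 𝓝 (b : ι → X), 0 < (b.toMatrix x).det :=
    hM.matrix_det.continuousAt.eventually_const_lt (by simp)
  have hcramer : ∀ᶠ x in 𝓝 (b : ι → X),
      ∀ i, 0 < (b.toMatrix x).transpose.cramer (b.coords c) i := by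
    refine eventually_all.2 fun i => ?_
    have hcont : Continuous fun x : ι → X => (b.toMatrix x).transpose.cramer (b.coords c) i :=
      (continuous_apply i).comp (hM.matrix_transpose.matrix_cramer continuous_const)
    refine hcont.continuousAt.eventually_const_lt ?_
    rw [b.interior_convexHull] at hc
    simpa using hc i
  filter_upwards [hdet, hcramer] with x hx hx'
  obtain ⟨hind, hspan⟩ := (b.isUnit_toMatrix_iff x).1
    ((Matrix.isUnit_iff_isUnit_det _).2 hx.ne'.isUnit)
  refine ⟨hind, ?_⟩
  let b' : AffineBasis ι ℝ X := ⟨x, hind, hspan⟩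
  change c ∈ interior (convexHull ℝ (Set.range b'))
  rw [b'.interior_convexHull]
  intro i
  have h := congrFun (b.det_smul_coords_eq_cramer_coords b' c) i
  have hpos := hx' i
  change 0 < (b.toMatrix b').transpose.cramer (b.coords c) i at hpos
  rw [← h] at hpos
  exact pos_of_mul_pos_right hpos hx.le

theorem simplex_interior_point_stable_under_perturbation
    {X : Type*} [NormedAddCommGroup X] [NormedSpace ℝ X]
    (n : ℕ) (hdim : Module.finrank ℝ X = n)
    (a : Fin (n + 1) → X) (ha : AffineIndependent ℝ a)
    (c : X) (hc : c ∈ interior (convexHull ℝ (Set.range a))) :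
    ∃ δ > 0, ∀ x : Fin (n + 1) → X, (∀ k, ‖x k - a k‖ < δ) →
      AffineIndependent ℝ x ∧ c ∈ interior (convexHull ℝ (Set.range x)) := by
  have hspan : affineSpan ℝ (Set.range a) = ⊤ :=
    affineSpan_eq_top_of_nonempty_interior ⟨c, hc⟩
  let b : AffineBasis (Fin (n + 1)) ℝ X := ⟨a, ha, hspan⟩
  obtain ⟨δ, hδ, h⟩ := Metric.eventually_nhds_iff.1 (b.eventually_mem_interior_convexHull hc)
  refine ⟨δ, hδ, fun x hx => h ((dist_pi_lt_iff hδ).2 fun k => ?_)⟩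
  rw [dist_eq_norm]
  exact hx k
end
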